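/- arXiv:1912.03562 — 3 statements merged into one kernel-verified Lean document; each statement's English description precedes it below -/
import Mathlib

section
/- Let R be a commutative domain with field of fractions Q and let B be an R-algebra. Then the Gelfand-Kirillov dimension of B over R equals the classical Gelfand-Kirillov dimension of the Q-algebra Q ⊗_R B, i.e. GKdim(B) = GKdim(Q ⊗_R B). -/
open TensorProduct Filter
open scoped ENNReal

/-- The rank of an `R`-module `M` over a commutative domain `R`:
the dimension over the field of fractions `Q = Frac(R)` of `Q ⊗[R] M`
(as a natural number; all modules to which this is applied are finitely generated,
so their rank is finite). -/
noncomputable def modRank (R : Type*) [CommRing R] [IsDomain R]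
    (M : Type*) [AddCommGroup M] [Module R M] : ℕ :=
  Module.finrank (FractionRing R) (FractionRing R ⊗[R] M)

/-- A frame of an `R`-algebra `B` is a finitely generated `R`-submodule of `B`
containing `1`. -/
def IsFrame (R : Type*) [CommRing R] {B : Type*} [Ring B] [Algebra R B]
    (V : Submodule R B) : Prop :=
  V.FG ∧ (1 : B) ∈ V

/-- The Gelfand-Kirillov dimension of an `R`-algebra `B` over a commutative domain `R`:
`GKdim(B) = sup_V limsup_{n → ∞} log_n (rank V^n)`, where `V` ranges over all
frames of `B`. -/
noncomputable def GKdim (R : Type*) [CommRing R] [IsDomain R]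
    (B : Type*) [Ring B] [Algebra R B] : ℝ≥0∞ :=
  ⨆ (V : Submodule R B) (_ : IsFrame R V),
    Filter.limsup
      (fun n : ℕ => ENNReal.ofReal (Real.logb n (modRank R ↥(V ^ n)))) Filter.atTop

namespace Submodule

section BaseChange

variable {R : Type*} [CommRing R] (A : Type*) [CommRing A] [Algebra R A]

theorem FG.baseChange_fg {M : Type*} [AddCommGroup M] [Module R M] {V : Submodule R M}
    (hV : V.FG) : (V.baseChange A).FG := by
  obtain ⟨s, hs, rfl⟩ := fg_def.1 hV
  rw [baseChange_span]
  exact fg_span (hs.image _)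

/-- Every finitely generated submodule of `A ⊗[R] M` is contained in the base change of a
finitely generated submodule of `M`. -/
theorem FG.exists_le_baseChange {M : Type*} [AddCommGroup M] [Module R M]
    {W : Submodule A (A ⊗[R] M)} (hW : W.FG) :
    ∃ V : Submodule R M, V.FG ∧ W ≤ V.baseChange A := by
  induction W, hW using fg_induction with
  | singleton x =>
    simp only [span_singleton_le_iff_mem]
    induction x using TensorProduct.induction_on with
    | zero => exact ⟨⊥, fg_bot, zero_mem _⟩
    | tmul a m =>
      exact ⟨span R {m}, fg_span_singleton m,
        tmul_mem_baseChange_of_mem a (mem_span_singleton_self m)⟩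
    | add x y hx hy =>
      obtain ⟨V, hV, hxV⟩ := hx
      obtain ⟨V', hV', hyV'⟩ := hy
      exact ⟨V ⊔ V', hV.sup hV', add_mem (baseChange_mono A le_sup_left hxV)
        (baseChange_mono A le_sup_right hyV')⟩
  | sup W W' _ _ hW hW' =>
    obtain ⟨V, hV, hWV⟩ := hW
    obtain ⟨V', hV', hWV'⟩ := hW'
    exact ⟨V ⊔ V', hV.sup hV', sup_le (hWV.trans (baseChange_mono A le_sup_left))
      (hWV'.trans (baseChange_mono A le_sup_right))⟩

variable {B : Type*} [Ring B] [Algebra R B]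

theorem baseChange_one_eq_one : (1 : Submodule R B).baseChange A = 1 := by
  rw [one_eq_span, baseChange_span, one_eq_span, Set.image_singleton]
  rfl

theorem baseChange_mul_eq_mul (V W : Submodule R B) :
    (V * W).baseChange A = V.baseChange A * W.baseChange A := by
  rw [baseChange_eq_span A V, baseChange_eq_span A W, span_mul_span, mul_eq_span_mul_set,
    baseChange_span]
  congr 1
  exact Set.image_mul (Algebra.TensorProduct.includeRight : B →ₐ[R] A ⊗[R] B)

theorem baseChange_pow_eq_pow (V : Submodule R B) (n : ℕ) :
    (V ^ n).baseChange A = V.baseChange A ^ n := by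
  induction n with
  | zero => rw [pow_zero, pow_zero, baseChange_one_eq_one]
  | succ n ih => rw [pow_succ, pow_succ, baseChange_mul_eq_mul, ih]

end BaseChange

end Submodule

theorem IsFrame.baseChange {R : Type*} [CommRing R] (A : Type*) [CommRing A] [Algebra R A]
    {B : Type*} [Ring B] [Algebra R B] {V : Submodule R B} (hV : IsFrame R V) :
    IsFrame A (V.baseChange A) :=
  ⟨hV.1.baseChange_fg A, Submodule.tmul_mem_baseChange_of_mem 1 hV.2⟩

theorem modRank_eq_finrank (K M : Type*) [Field K] [AddCommGroup M] [Module K M] :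
    modRank K M = Module.finrank K M :=
  Module.finrank_baseChange

theorem modRank_eq_finrank_baseChange {R M : Type*} [CommRing R] [IsDomain R]
    [AddCommGroup M] [Module R M] (V : Submodule R M) :
    modRank R V = Module.finrank (FractionRing R) (V.baseChange (FractionRing R)) := by
  have h : Function.Injective (V.subtype.baseChange (FractionRing R)) :=
    Module.Flat.lTensor_preserves_injective_linearMap V.subtype V.injective_subtype
  exact (LinearEquiv.ofInjective _ h).finrank_eq

theorem Real.logb_natCast_le_logb_natCast {a b : ℕ} (n : ℕ) (h : a ≤ b) :
    Real.logb n a ≤ Real.logb n b := by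
  unfold Real.logb
  have : Real.log a ≤ Real.log b := by
    rcases Nat.eq_zero_or_pos a with rfl | ha
    · simpa using Real.log_natCast_nonneg b
    · gcongr
  exact div_le_div_of_nonneg_right this (Real.log_natCast_nonneg n)

/-- For a commutative domain `R` with field of fractions `Q` and an
`R`-algebra `B`, the Gelfand-Kirillov dimension of `B` over `R` equals the (classical)
Gelfand-Kirillov dimension of the `Q`-algebra `Q ⊗[R] B`. -/
theorem GKdim_eq_GKdim_fractionRing_tensor (R : Type*) [CommRing R] [IsDomain R]
    (B : Type*) [Ring B] [Algebra R B] :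
    GKdim R B = GKdim (FractionRing R) (FractionRing R ⊗[R] B) := by
  have key (V : Submodule R B) (n : ℕ) : modRank R ↥(V ^ n) =
      modRank (FractionRing R) ↥(V.baseChange (FractionRing R) ^ n) := by
    rw [modRank_eq_finrank_baseChange, modRank_eq_finrank, Submodule.baseChange_pow_eq_pow]
  apply le_antisymm
  · refine iSup₂_le fun V hV ↦ ?_
    simp only [key]
    exact le_iSup₂_of_le (V.baseChange (FractionRing R)) (hV.baseChange _) le_rfl
  · refine iSup₂_le fun W hW ↦ ?_
    obtain ⟨V, hV, hWV⟩ := hW.1.exists_le_baseChange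
    have hF : IsFrame R (V ⊔ 1) :=
      ⟨hV.sup (Submodule.one_eq_span (R := R) (A := B) ▸ Submodule.fg_span_singleton 1),
        Submodule.one_le.1 le_sup_right⟩
    refine le_iSup₂_of_le (V ⊔ 1) hF (limsup_le_limsup (.of_forall fun n ↦ ?_))
    refine ENNReal.ofReal_le_ofReal (Real.logb_natCast_le_logb_natCast n ?_)
    rw [key, modRank_eq_finrank, modRank_eq_finrank]
    have : Module.Finite (FractionRing R) ↥((V ⊔ 1).baseChange (FractionRing R) ^ n) :=
      Module.Finite.iff_fg.2 ((hF.1.baseChange_fg _).pow n)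
    exact Submodule.finrank_mono
      (pow_le_pow_left' (hWV.trans (Submodule.baseChange_mono _ le_sup_left)) n)
end

section
/- Let R be a commutative domain and B a finitely generated R-algebra. Then GKdim(B) = 0 if and only if rank B := dim_Q(Q ⊗_R B) is finite, where Q is the field of fractions of R. -/
open TensorProduct Filter
open scoped ENNReal

section Frame

variable {K A : Type*} [CommSemiring K] [Semiring A] [Algebra K A] {W : Submodule K A}

theorem adjoin_le_pow_of_pow_succ_le (h1 : (1 : A) ∈ W) {n : ℕ} (h : W ^ (n + 1) ≤ W ^ n) :
    Subalgebra.toSubmodule (Algebra.adjoin K (W : Set A)) ≤ W ^ n := by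
  have key : ∀ b ∈ Algebra.adjoin K (W : Set A), ∀ u ∈ W ^ n, u * b ∈ W ^ n := by
    intro b hb
    induction hb using Algebra.adjoin_induction with
    | mem x hx =>
      intro u hu
      exact h (pow_succ W n ▸ Submodule.mul_mem_mul hu hx)
    | algebraMap r =>
      intro u hu
      rw [← Algebra.commutes, ← Algebra.smul_def]
      exact Submodule.smul_mem _ _ hu
    | add x y _ _ hx hy =>
      intro u hu
      rw [mul_add]
      exact Submodule.add_mem _ (hx u hu) (hy u hu)
    | mul x y _ _ hx hy =>
      intro u hu
      rw [← mul_assoc]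
      exact hy _ (hx u hu)
  intro b hb
  simpa using key b hb 1 (Submodule.one_le.mp (one_le_pow₀ (Submodule.one_le.mpr h1)))

end Frame

theorem le_finrank_pow {K A : Type*} [Field K] [Ring A] [Algebra K A] {W : Submodule K A}
    (h1 : (1 : A) ∈ W) (hW : W.FG) (hadj : Algebra.adjoin K (W : Set A) = ⊤)
    (hA : ¬ Module.Finite K A) (n : ℕ) : n ≤ Module.finrank K ↥(W ^ n) := by
  induction n with
  | zero => exact Nat.zero_le _
  | succ n ih =>
    have hlt : W ^ n < W ^ (n + 1) := by
      refine (pow_le_pow_right₀ (Submodule.one_le.mpr h1) n.le_succ).lt_of_not_ge fun h => hA ?_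
      have htop : W ^ n = ⊤ := by
        rw [eq_top_iff, ← Algebra.top_toSubmodule, ← hadj]
        exact adjoin_le_pow_of_pow_succ_le h1 h
      exact ⟨htop ▸ hW.pow n⟩
    have : Module.Finite K ↥(W ^ (n + 1)) := Module.Finite.iff_fg.mpr (hW.pow _)
    exact Nat.succ_le_of_lt (ih.trans_lt (Submodule.finrank_lt_finrank_of_lt hlt))

section BaseChange

variable {R : Type*} [CommRing R] {B : Type*} [Ring B] [Algebra R B]

theorem Submodule.baseChange_pow (Q : Type*) [CommRing Q] [Algebra R Q] (V : Submodule R B)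
    (n : ℕ) : (V ^ n).baseChange Q = V.baseChange Q ^ n := by
  rw [← V.span_eq, Submodule.span_pow, Submodule.baseChange_span, Submodule.baseChange_span,
    Submodule.span_pow]
  congr 1
  exact Set.image_pow (Algebra.TensorProduct.includeRight : B →ₐ[R] Q ⊗[R] B) _ n

theorem adjoin_baseChange_eq_top (Q : Type*) [CommRing Q] [Algebra R Q] {V : Submodule R B}
    (hV : Algebra.adjoin R (V : Set B) = ⊤) :
    Algebra.adjoin Q (V.baseChange Q : Set (Q ⊗[R] B)) = ⊤ := by
  set T := Algebra.adjoin Q (V.baseChange Q : Set (Q ⊗[R] B))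
  have hB : Algebra.adjoin R (V : Set B) ≤
      (T.restrictScalars R).comap Algebra.TensorProduct.includeRight :=
    Algebra.adjoin_le fun b hb =>
      Algebra.subset_adjoin (Submodule.tmul_mem_baseChange_of_mem 1 hb)
  rw [eq_top_iff]
  rintro x -
  induction x with
  | zero => exact T.zero_mem
  | add x y hx hy => exact T.add_mem hx hy
  | tmul q b =>
    have hb : (1 : Q) ⊗ₜ[R] b ∈ T := hB (hV ▸ Algebra.mem_top)
    simpa [TensorProduct.smul_tmul'] using T.smul_mem hb q

variable [IsDomain R]

theorem modRank_submodule (V : Submodule R B) :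
    modRank R ↥V = Module.finrank (FractionRing R) ↥(V.baseChange (FractionRing R)) :=
  (Submodule.toBaseChange.toLinearEquiv (FractionRing R) V).finrank_eq

theorem GKdim_eq_zero_of_finite [Module.Finite (FractionRing R) (FractionRing R ⊗[R] B)] :
    GKdim R B = 0 := by
  simp only [GKdim, ENNReal.iSup_eq_zero]
  intro V _
  set d := Module.finrank (FractionRing R) (FractionRing R ⊗[R] B)
  have hd : Tendsto (fun n : ℕ => Real.log d / Real.log n) atTop (nhds 0) :=
    tendsto_const_nhds.div_atTop (Real.tendsto_log_atTop.comp tendsto_natCast_atTop_atTop)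
  have hlim : Tendsto (fun n : ℕ => ENNReal.ofReal (Real.log d / Real.log n)) atTop (nhds 0) := by
    simpa using ENNReal.tendsto_ofReal hd
  refine (tendsto_of_tendsto_of_tendsto_of_le_of_le tendsto_const_nhds hlim
    (fun _ => zero_le) fun n => ENNReal.ofReal_le_ofReal ?_).limsup_eq
  refine div_le_div_of_nonneg_right ?_ (Real.log_natCast_nonneg n)
  rcases Nat.eq_zero_or_pos (modRank R ↥(V ^ n)) with h0 | hpos
  · simpa [h0] using Real.log_natCast_nonneg d
  · refine Real.log_le_log (by exact_mod_cast hpos) ?_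
    rw [modRank_submodule]
    exact_mod_cast Submodule.finrank_le _

theorem one_le_GKdim_of_not_finite (hfg : Algebra.FiniteType R B)
    (h : ¬ Module.Finite (FractionRing R) (FractionRing R ⊗[R] B)) : 1 ≤ GKdim R B := by
  obtain ⟨S, hS⟩ := hfg.out
  set V : Submodule R B := Submodule.span R (insert 1 (S : Set B))
  have h1 : (1 : B) ∈ V := Submodule.subset_span (Set.mem_insert _ _)
  have hVfg : V.FG := Submodule.fg_span (S.finite_toSet.insert 1)
  have hWfg : (V.baseChange (FractionRing R)).FG := by
    rw [Submodule.baseChange_span]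
    exact Submodule.fg_span ((S.finite_toSet.insert 1).image _)
  have hadj : Algebra.adjoin R (V : Set B) = ⊤ := by
    rw [eq_top_iff, ← hS]
    exact Algebra.adjoin_mono ((Set.subset_insert _ _).trans Submodule.subset_span)
  have hrank (n : ℕ) : n ≤ modRank R ↥(V ^ n) := by
    rw [modRank_submodule, Submodule.baseChange_pow]
    exact le_finrank_pow (Submodule.tmul_mem_baseChange_of_mem 1 h1) hWfg
      (adjoin_baseChange_eq_top _ hadj) h n
  refine le_iSup₂_of_le V ⟨hVfg, h1⟩ (le_limsup_of_frequently_le' (Eventually.frequently ?_))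
  filter_upwards [eventually_ge_atTop 2] with n hn
  rw [ENNReal.one_le_ofReal, Real.le_logb_iff_rpow_le (by exact_mod_cast hn)
    (by exact_mod_cast (by lia : 0 < n).trans_le (hrank n)), Real.rpow_one]
  exact_mod_cast hrank n

end BaseChange

/-- For a finitely generated algebra `B` over a commutative domain `R`
with field of fractions `Q`, `GKdim(B) = 0` if and only if
`rank B = dim_Q (Q ⊗[R] B)` is finite. -/
theorem GKdim_eq_zero_iff_rank_finite (R : Type*) [CommRing R] [IsDomain R]
    (B : Type*) [Ring B] [Algebra R B] (hfg : Algebra.FiniteType R B) :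
    GKdim R B = 0 ↔
      Module.rank (FractionRing R) (FractionRing R ⊗[R] B) < Cardinal.aleph0 := by
  rw [Module.rank_lt_aleph0_iff]
  refine ⟨fun h => ?_, fun _ => GKdim_eq_zero_of_finite⟩
  by_contra hfin
  exact one_ne_zero (le_zero_iff.mp (h ▸ one_le_GKdim_of_not_finite hfg hfin))
end

section
/- Let R be a commutative domain, B an R-algebra, and C an R-subalgebra of B. Then GKdim(C) ≤ GKdim(B). Moreover, if C is contained in the center Z(B) of B and B is finitely generated as a C-module, then GKdim(C) = GKdim(B). -/
open TensorProduct Filter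
open scoped ENNReal

section Rank

variable {R : Type*} [CommRing R] [IsDomain R] {M N : Type*} [AddCommGroup M] [Module R M]
  [AddCommGroup N] [Module R N]

theorem modRank_le_of_injective [Module.Finite R N] (f : M →ₗ[R] N)
    (hf : Function.Injective f) : modRank R M ≤ modRank R N :=
  LinearMap.finrank_le_finrank_of_injective (f := f.baseChange (FractionRing R))
    (Module.Flat.lTensor_preserves_injective_linearMap f hf)

theorem modRank_le_of_surjective [Module.Finite R M] (f : M →ₗ[R] N)
    (hf : Function.Surjective f) : modRank R N ≤ modRank R M :=
  (f.baseChange (FractionRing R)).finrank_le_finrank_of_surjective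
    (LinearMap.lTensor_surjective _ hf)

theorem modRank_congr (e : M ≃ₗ[R] N) : modRank R M = modRank R N :=
  (e.baseChange R (FractionRing R) M N).finrank_eq

theorem modRank_fun (ι : Type*) [Fintype ι] [Module.Finite R M] :
    modRank R (ι → M) = Fintype.card ι * modRank R M := by
  classical
  unfold modRank
  rw [(TensorProduct.piRight R (FractionRing R) (FractionRing R) fun _ : ι => M).finrank_eq,
    Module.finrank_pi_fintype]
  simp

theorem modRank_mono {P P' : Submodule R M} (h : P ≤ P') (hP' : P'.FG) :
    modRank R P ≤ modRank R P' :=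
  have := Module.Finite.iff_fg.mpr hP'
  modRank_le_of_injective _ (Submodule.inclusion_injective h)

theorem modRank_mul_span_le {B : Type*} [Ring B] [Algebra R B] {P : Submodule R B} (hP : P.FG)
    (S : Finset B) :
    modRank R ↥(P * Submodule.span R (S : Set B)) ≤ S.card * modRank R P := by
  classical
  have := Module.Finite.iff_fg.mpr hP
  let f : (S → P) →ₗ[R] B :=
    ∑ s : S, (LinearMap.mulRight R (s : B)) ∘ₗ P.subtype ∘ₗ LinearMap.proj s
  have hf : P * Submodule.span R (S : Set B) ≤ LinearMap.range f := by
    refine Submodule.mul_le.mpr fun p hp x hx => ?_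
    induction hx using Submodule.span_induction with
    | mem x hx =>
      refine ⟨Pi.single ⟨x, hx⟩ ⟨p, hp⟩, ?_⟩
      simp only [f, LinearMap.sum_apply, LinearMap.comp_apply, LinearMap.proj_apply,
        Submodule.subtype_apply, LinearMap.mulRight_apply]
      rw [Finset.sum_eq_single ⟨x, hx⟩]
      · simp
      · intro s _ hs
        simp [Pi.single_eq_of_ne hs]
      · simp
    | zero => simp
    | add x y _ _ hx hy => rw [mul_add]; exact add_mem hx hy
    | smul r x _ hx => rw [mul_smul_comm]; exact Submodule.smul_mem _ _ hx
  calc modRank R ↥(P * Submodule.span R (S : Set B))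
      ≤ modRank R (LinearMap.range f) :=
        modRank_mono hf (Module.Finite.iff_fg.mp inferInstance)
    _ ≤ modRank R (S → P) := modRank_le_of_surjective _ f.surjective_rangeRestrict
    _ = S.card * modRank R P := by rw [modRank_fun, Fintype.card_coe]

end Rank

theorem limsup_logb_le_of_le_mul {a b : ℕ → ℕ} (m : ℕ) (h : ∀ n, a n ≤ m * b n) :
    limsup (fun n : ℕ => ENNReal.ofReal (Real.logb n (a n))) atTop ≤
      limsup (fun n : ℕ => ENNReal.ofReal (Real.logb n (b n))) atTop := by
  have hm : Tendsto (fun n : ℕ => ENNReal.ofReal (Real.logb n m)) atTop (nhds 0) := by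
    rw [← ENNReal.ofReal_zero]
    exact ENNReal.tendsto_ofReal
      ((Real.tendsto_log_atTop.comp tendsto_natCast_atTop_atTop).const_div_atTop (Real.log m))
  calc limsup (fun n : ℕ => ENNReal.ofReal (Real.logb n (a n))) atTop
      ≤ limsup ((fun n : ℕ => ENNReal.ofReal (Real.logb n m)) +
          fun n : ℕ => ENNReal.ofReal (Real.logb n (b n))) atTop := by
        refine limsup_le_limsup ?_
        filter_upwards [eventually_ge_atTop 2] with n hn
        rcases Nat.eq_zero_or_pos (a n) with ha | ha
        · simp [ha]
        have hmb : 0 < m * b n := ha.trans_le (h n)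
        have hm0 : (m : ℝ) ≠ 0 := by exact_mod_cast (Nat.pos_of_mul_pos_right hmb).ne'
        have hb0 : (b n : ℝ) ≠ 0 := by exact_mod_cast (Nat.pos_of_mul_pos_left hmb).ne'
        refine le_trans (ENNReal.ofReal_le_ofReal ?_) ENNReal.ofReal_add_le
        rw [← Real.logb_mul hm0 hb0]
        exact Real.logb_le_logb_of_le (by exact_mod_cast hn) (by exact_mod_cast ha)
          (by exact_mod_cast h n)
    _ = limsup (fun n : ℕ => ENNReal.ofReal (Real.logb n (b n))) atTop :=
        ENNReal.limsup_add_of_left_tendsto_zero hm _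

section Subalgebra

variable {R : Type*} [CommRing R] {B : Type*} [Ring B] [Algebra R B] {C : Subalgebra R B}

theorem IsFrame.map_val {V : Submodule R C} (hV : IsFrame R V) :
    IsFrame R (V.map C.val.toLinearMap) :=
  ⟨hV.1.map _, 1, hV.2, map_one C.val⟩

theorem modRank_map_val_pow [IsDomain R] (V : Submodule R C) (n : ℕ) :
    modRank R ↥((V.map C.val.toLinearMap) ^ n) = modRank R ↥(V ^ n) := by
  rw [← Submodule.map_pow]
  exact (modRank_congr (Submodule.equivMapOfInjective _ Subtype.val_injective _)).symm

/-- If `S` generates `B` over `C`, then every finitely generated `R`-submodule of `B` has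
coefficients with respect to `S` in some frame of `C`. -/
theorem exists_isFrame_le_map_mul_span {S : Finset B}
    (hS : Submodule.span C (S : Set B) = ⊤) {M : Submodule R B} (hM : M.FG) :
    ∃ W : Submodule R C, IsFrame R W ∧
      M ≤ W.map C.val.toLinearMap * Submodule.span R (S : Set B) := by
  classical
  obtain ⟨T, rfl⟩ := hM
  have hc : ∀ x : B, ∃ c : B → C, ∑ s ∈ S, c s • s = x := fun x => by
    obtain ⟨c, -, hc⟩ := Submodule.mem_span_finset.mp (hS ▸ Submodule.mem_top : x ∈ _)
    exact ⟨c, hc⟩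
  choose c hc using hc
  refine ⟨Submodule.span R ↑(insert 1 ((T ×ˢ S).image fun p => c p.1 p.2)),
    ⟨⟨_, rfl⟩, Submodule.subset_span (by simp)⟩, Submodule.span_le.mpr fun t ht => ?_⟩
  rw [SetLike.mem_coe, ← hc t]
  refine sum_mem fun s hs => ?_
  refine Submodule.mul_mem_mul (Submodule.mem_map_of_mem (f := C.val.toLinearMap)
    (Submodule.subset_span ?_)) (Submodule.subset_span hs)
  exact Finset.mem_insert_of_mem
    (Finset.mem_image.mpr ⟨(t, s), Finset.mem_product.mpr ⟨ht, hs⟩, rfl⟩)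

theorem pow_mul_le_pow_mul_of_mul_le {V W N : Submodule R B}
    (hVW : Commute V W) (h : V * N ≤ W * N) (n : ℕ) : V ^ n * N ≤ W ^ n * N := by
  induction n with
  | zero => simp
  | succ n ih =>
    calc V ^ (n + 1) * N = V ^ n * (V * N) := by rw [pow_succ, mul_assoc]
      _ ≤ V ^ n * (W * N) := mul_le_mul_right h _
      _ = W * (V ^ n * N) := by rw [← mul_assoc, (hVW.pow_left n).eq, mul_assoc]
      _ ≤ W * (W ^ n * N) := mul_le_mul_right ih _
      _ = W ^ (n + 1) * N := by rw [pow_succ', mul_assoc]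

theorem commute_map_val_of_le_center (hC : C ≤ Subalgebra.center R B) (V : Submodule R B)
    (W : Submodule R C) : Commute V (W.map C.val.toLinearMap) := by
  refine Submodule.mul_comm_of_commute ?_
  rintro v _ hv ⟨w, -, rfl⟩
  exact Subalgebra.mem_center_iff.mp (hC w.2) v

end Subalgebra

theorem GKdim_subalgebra_le (R : Type*) [CommRing R] [IsDomain R]
    {B : Type*} [Ring B] [Algebra R B] (C : Subalgebra R B) : GKdim R C ≤ GKdim R B := by
  refine iSup₂_le fun V hV => ?_
  refine le_trans (le_of_eq ?_)
    (le_iSup₂ (V.map C.val.toLinearMap) hV.map_val)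
  simp_rw [modRank_map_val_pow]

theorem GKdim_le_of_le_center_of_finite (R : Type*) [CommRing R] [IsDomain R]
    {B : Type*} [Ring B] [Algebra R B] (C : Subalgebra R B)
    (hC : C ≤ Subalgebra.center R B) [Module.Finite C B] : GKdim R B ≤ GKdim R C := by
  classical
  obtain ⟨S₀, hS₀⟩ := Module.finite_def.mp ‹Module.Finite C B›
  let S := insert 1 S₀
  have hS : Submodule.span C (S : Set B) = ⊤ :=
    top_unique (hS₀ ▸ Submodule.span_mono (Finset.subset_insert _ _))
  let N := Submodule.span R (S : Set B)
  have hN : 1 ≤ N :=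
    Submodule.one_le.mpr (Submodule.subset_span (Finset.mem_insert_self _ _))
  refine iSup₂_le fun V hV => ?_
  obtain ⟨W, hW, hVW⟩ :=
    exists_isFrame_le_map_mul_span hS (hV.1.mul (⟨S, rfl⟩ : N.FG))
  refine le_iSup₂_of_le W hW (limsup_logb_le_of_le_mul S.card fun n => ?_)
  have hWn := hW.map_val.1.pow n
  calc modRank R ↥(V ^ n)
      ≤ modRank R ↥((W.map C.val.toLinearMap) ^ n * N) :=
        modRank_mono ((le_mul_of_one_le_right' hN).trans
          (pow_mul_le_pow_mul_of_mul_le (commute_map_val_of_le_center hC V W) hVW n))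
          (hWn.mul ⟨S, rfl⟩)
    _ ≤ S.card * modRank R ↥((W.map C.val.toLinearMap) ^ n) := modRank_mul_span_le hWn S
    _ = S.card * modRank R ↥(W ^ n) := by rw [modRank_map_val_pow]

/-- For an `R`-subalgebra `C` of an `R`-algebra `B` over a commutative
domain `R`, `GKdim(C) ≤ GKdim(B)`; moreover, if `C` is contained in the center of `B`
and `B` is finitely generated as a `C`-module, then `GKdim(C) = GKdim(B)`. -/
theorem GKdim_subalgebra (R : Type*) [CommRing R] [IsDomain R]
    (B : Type*) [Ring B] [Algebra R B] (C : Subalgebra R B) :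
    GKdim R ↥C ≤ GKdim R B ∧
      (C ≤ Subalgebra.center R B → Module.Finite ↥C B → GKdim R ↥C = GKdim R B) :=
  ⟨GKdim_subalgebra_le R C, fun hC _ =>
    (GKdim_subalgebra_le R C).antisymm (GKdim_le_of_le_center_of_finite R C hC)⟩
end
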